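/- Let Γ be a set of formulas contained in 𝐏 ∪ 𝐍 and let A be a positive formula (A ∈ 𝐏). If Γ ⊢_I A then Pos(Γ) ⊢_I A. -/

import Mathlib

namespace ASP

/-- Propositional formulas over atoms `α`, built with ∧, ∨, ← and ⊥.
`impl A B` denotes the formula `B ← A` (i.e. `A → B`). -/
inductive PropForm (α : Type) : Type
  | var : α → PropForm α
  | fals : PropForm α
  | conj : PropForm α → PropForm α → PropForm α
  | disj : PropForm α → PropForm α → PropForm α
  | impl : PropForm α → PropForm α → PropForm α
  deriving DecidableEq

namespace PropForm

variable {α : Type}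

/-- `¬F` abbreviates `⊥ ← F`. -/
def neg (A : PropForm α) : PropForm α := impl A fals

/-- `⊤` abbreviates `⊥ ← ⊥`. -/
def top : PropForm α := impl fals fals

/-- The set of atoms occurring in a formula. -/
def atoms : PropForm α → Set α
  | var a => {a}
  | fals => ∅
  | conj A B => atoms A ∪ atoms B
  | disj A B => atoms A ∪ atoms B
  | impl A B => atoms A ∪ atoms B

end PropForm

open PropForm

/-- Hilbert-style derivability for intuitionistic propositional logic,
with an extra set `Ax` of additional axioms. -/
inductive Deriv {α : Type} (Ax : Set (PropForm α)) : PropForm α → Prop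
  | ax {A} : A ∈ Ax → Deriv Ax A
  | k (A B) : Deriv Ax (impl A (impl B A))
  | s (A B C) : Deriv Ax (impl (impl A (impl B C)) (impl (impl A B) (impl A C)))
  | conjIntro (A B) : Deriv Ax (impl A (impl B (conj A B)))
  | conjElimL (A B) : Deriv Ax (impl (conj A B) A)
  | conjElimR (A B) : Deriv Ax (impl (conj A B) B)
  | disjIntroL (A B) : Deriv Ax (impl A (disj A B))
  | disjIntroR (A B) : Deriv Ax (impl B (disj A B))
  | disjElim (A B C) : Deriv Ax (impl (impl A C) (impl (impl B C) (impl (disj A B) C)))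
  | falsElim (A) : Deriv Ax (impl fals A)
  | mp {A B} : Deriv Ax (impl A B) → Deriv Ax A → Deriv Ax B

/-- `F` is a theorem of intuitionistic propositional logic. -/
def IThm {α : Type} (F : PropForm α) : Prop := Deriv ∅ F

/-- `F` is a theorem of classical propositional logic
(intuitionistic logic plus double-negation elimination). -/
def CThm {α : Type} (F : PropForm α) : Prop :=
  Deriv {F | ∃ A, F = impl (neg (neg A)) A} F

/-- Conjunction of a finite list of formulas (empty conjunction is ⊤). -/
def bigConj {α : Type} : List (PropForm α) → PropForm α
  | [] => top
  | [A] => A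
  | A :: L => conj A (bigConj L)

/-- Disjunction of a finite list of formulas (empty disjunction is ⊥). -/
def bigDisj {α : Type} : List (PropForm α) → PropForm α
  | [] => fals
  | [A] => A
  | A :: L => disj A (bigDisj L)

/-- `T ⊢_X F`: the formula `F ← (F₁ ∧ ... ∧ Fₙ)` is a theorem of the logic
whose theorems are `Thm`, for some `F₁, ..., Fₙ ∈ T`. -/
def ProvesFrom {α : Type} (Thm : PropForm α → Prop) (T : Set (PropForm α))
    (F : PropForm α) : Prop :=
  ∃ L : List (PropForm α), (∀ G ∈ L, G ∈ T) ∧ Thm (impl (bigConj L) F)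

/-- `T ⊢_I F`. -/
def IProves {α : Type} (T : Set (PropForm α)) (F : PropForm α) : Prop :=
  ProvesFrom IThm T F

/-- `T ⊢_C F`. -/
def CProves {α : Type} (T : Set (PropForm α)) (F : PropForm α) : Prop :=
  ProvesFrom CThm T F

/-- `T` is consistent in intuitionistic logic. -/
def IConsistent {α : Type} (T : Set (PropForm α)) : Prop := ¬ IProves T fals

/-- `T ⊩_I M`: `T` is consistent and proves (intuitionistically) every atom of `M`. -/
def IProvesAll {α : Type} (T : Set (PropForm α)) (M : Set α) : Prop :=
  IConsistent T ∧ ∀ a ∈ M, IProves T (var a)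

/-- `T ≡_I U`: the two theories prove each other's formulas intuitionistically. -/
def IEquivTh {α : Type} (T U : Set (PropForm α)) : Prop :=
  (∀ F ∈ U, IProves T F) ∧ (∀ F ∈ T, IProves U F)

/-- The signature (set of occurring atoms) of a theory. -/
def sigTh {α : Type} (T : Set (PropForm α)) : Set α := ⋃ F ∈ T, F.atoms

/-- `T` is (literal) complete: for every atom `a` of its signature,
`T ⊢_I a` or `T ⊢_I ¬a`. -/
def IComplete {α : Type} (T : Set (PropForm α)) : Prop :=
  ∀ a ∈ sigTh T, IProves T (var a) ∨ IProves T (neg (var a))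

/-- `{¬a : a ∈ S}`. -/
def negSet {α : Type} (S : Set α) : Set (PropForm α) := (fun a => neg (var a)) '' S

/-- `{¬¬a : a ∈ S}`. -/
def negnegSet {α : Type} (S : Set α) : Set (PropForm α) :=
  (fun a => neg (neg (var a))) '' S

/-- Classical two-valued satisfaction, identifying an interpretation with the
set of atoms it makes true. -/
def sat2 {α : Type} (X : Set α) : PropForm α → Prop
  | .var a => a ∈ X
  | .fals => False
  | .conj A B => sat2 X A ∧ sat2 X B
  | .disj A B => sat2 X A ∨ sat2 X B
  | .impl A B => sat2 X A → sat2 X B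

/-- `X` is a classical model of the theory `T`. -/
def isModel2 {α : Type} (X : Set α) (T : Set (PropForm α)) : Prop := ∀ F ∈ T, sat2 X F

/-- `M` is a minimal (under ⊆) classical model of `T`. -/
def isMinModel {α : Type} (T : Set (PropForm α)) (M : Set α) : Prop :=
  isModel2 M T ∧ ∀ N ⊆ M, isModel2 N T → N = M

/-- Evaluation in the 3-valued Gödel logic G3. -/
def g3 {α : Type} (I : α → Fin 3) : PropForm α → Fin 3
  | .var a => I a
  | .fals => 0
  | .conj A B => min (g3 I A) (g3 I B)
  | .disj A B => max (g3 I A) (g3 I B)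
  | .impl A B => if g3 I A ≤ g3 I B then 2 else g3 I B

/-- Nested formulas: built from atoms, ⊤ and ⊥ using ∧, ∨ and ¬. -/
inductive NF (α : Type) : Type
  | var : α → NF α
  | top : NF α
  | bot : NF α
  | conj : NF α → NF α → NF α
  | disj : NF α → NF α → NF α
  | neg : NF α → NF α
  deriving DecidableEq

namespace NF

variable {α : Type}

/-- Reading a nested formula as a propositional formula
(`⊤ = ⊥ ← ⊥` and `¬F = ⊥ ← F`). -/
def toProp : NF α → PropForm α
  | var a => .var a
  | top => PropForm.top
  | bot => .fals
  | conj A B => .conj (toProp A) (toProp B)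
  | disj A B => .disj (toProp A) (toProp B)
  | neg A => PropForm.neg (toProp A)

/-- Atoms occurring in a nested formula. -/
def atoms : NF α → Set α
  | var a => {a}
  | top => ∅
  | bot => ∅
  | conj A B => atoms A ∪ atoms B
  | disj A B => atoms A ∪ atoms B
  | neg A => atoms A

/-- Satisfaction of a (basic, negation-free) nested formula by a set of atoms. -/
def satB (X : Set α) : NF α → Prop
  | var a => a ∈ X
  | top => True
  | bot => False
  | conj A B => satB X A ∧ satB X B
  | disj A B => satB X A ∨ satB X B
  | neg A => ¬ satB X A

open scoped Classical in
/-- The reduct `F^X`: each maximal subformula `¬G` is replaced by ⊥ if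
`X ⊨ G^X` and by ⊤ otherwise. -/
noncomputable def reduct (X : Set α) : NF α → NF α
  | var a => var a
  | top => top
  | bot => bot
  | conj A B => conj (reduct X A) (reduct X B)
  | disj A B => disj (reduct X A) (reduct X B)
  | neg A => if satB X (reduct X A) then bot else top

end NF

/-- An augmented clause `H ← B` is a pair `(H, B)` of nested formulas. -/
abbrev AugClause (α : Type) := NF α × NF α

/-- The propositional formula `H ← B` of an augmented clause. -/
def clauseToProp {α : Type} (c : AugClause α) : PropForm α :=
  .impl c.2.toProp c.1.toProp

/-- The theory of an augmented program. -/
def progTh {α : Type} (P : List (AugClause α)) : Set (PropForm α) :=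
  {F | ∃ c ∈ P, clauseToProp c = F}

/-- The signature of an augmented program. -/
def progSig {α : Type} (P : List (AugClause α)) : Set α :=
  {a | ∃ c ∈ P, a ∈ c.1.atoms ∪ c.2.atoms}

/-- `X` is closed under the (basic) program `P`: for each clause `H ← B`,
`X ⊨ H` whenever `X ⊨ B`. -/
def closedUnder {α : Type} (X : Set α) (P : List (AugClause α)) : Prop :=
  ∀ c ∈ P, NF.satB X c.2 → NF.satB X c.1

/-- The reduct `P^X` of an augmented program. -/
noncomputable def progReduct {α : Type} (X : Set α) (P : List (AugClause α)) :
    List (AugClause α) :=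
  P.map fun c => (c.1.reduct X, c.2.reduct X)

/-- `M` is an answer set of `P`: `M` is minimal (under ⊆) among the sets of
atoms closed under the reduct `P^M`. -/
def isAnswerSet {α : Type} (P : List (AugClause α)) (M : Set α) : Prop :=
  closedUnder M (progReduct M P) ∧ ∀ N ⊆ M, closedUnder N (progReduct M P) → N = M

/-- `M` is a min-answer set of `P`: both an answer set and a minimal model. -/
def isMinAnswerSet {α : Type} (P : List (AugClause α)) (M : Set α) : Prop :=
  isAnswerSet P M ∧ isMinModel (progTh P) M

/-- A G3 interpretation models an augmented program. -/
def g3ModelsProg {α : Type} (I : α → Fin 3) (P : List (AugClause α)) : Prop :=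
  ∀ c ∈ P, g3 I (clauseToProp c) = 2

/-- A free clause: a list of head literals and a list of body literals,
a literal being an atom `(a, true)` or a negated atom `(a, false)`.
It denotes `h₁ ∨ ... ∨ hₙ ← b₁ ∧ ... ∧ bₘ` (empty head = ⊥, empty body = ⊤). -/
structure FClause (α : Type) where
  head : List (α × Bool)
  body : List (α × Bool)
  deriving DecidableEq

/-- The propositional formula of a literal. -/
def litToProp {α : Type} : α × Bool → PropForm α
  | (a, true) => .var a
  | (a, false) => PropForm.neg (.var a)

/-- The nested formula of a literal. -/
def litToNF {α : Type} : α × Bool → NF α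
  | (a, true) => .var a
  | (a, false) => .neg (.var a)

/-- Disjunction of a list of nested formulas (empty = ⊥). -/
def bigDisjNF {α : Type} : List (NF α) → NF α
  | [] => .bot
  | [A] => A
  | A :: L => .disj A (bigDisjNF L)

/-- Conjunction of a list of nested formulas (empty = ⊤). -/
def bigConjNF {α : Type} : List (NF α) → NF α
  | [] => .top
  | [A] => A
  | A :: L => .conj A (bigConjNF L)

namespace FClause

variable {α : Type}

/-- The propositional formula of a free clause. -/
def toProp (c : FClause α) : PropForm α :=
  .impl (bigConj (c.body.map litToProp)) (bigDisj (c.head.map litToProp))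

/-- A free clause as an augmented clause. -/
def toAug (c : FClause α) : AugClause α :=
  (bigDisjNF (c.head.map litToNF), bigConjNF (c.body.map litToNF))

/-- The atoms of a free clause. -/
def atomsF (c : FClause α) : Set α :=
  {a | (∃ b, (a, b) ∈ c.head) ∨ (∃ b, (a, b) ∈ c.body)}

/-- A general clause: all head literals are positive atoms. -/
def isGeneral (c : FClause α) : Prop := ∀ l ∈ c.head, l.2 = true

/-- A disjunctive clause: a general clause with nonempty head. -/
def isDisjunctive (c : FClause α) : Prop := c.isGeneral ∧ c.head ≠ []

/-- A constraint: a clause with empty head (head ⊥). -/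
def isConstraint (c : FClause α) : Prop := c.head = []

end FClause

/-- The theory of a free program. -/
def fTh {α : Type} (P : List (FClause α)) : Set (PropForm α) :=
  {F | ∃ c ∈ P, c.toProp = F}

/-- The signature of a free program. -/
def fSig {α : Type} (P : List (FClause α)) : Set α :=
  {a | ∃ c ∈ P, a ∈ c.atomsF}

/-- `GenDisj(P)`: each constraint `⊥ ← B` is replaced by `p ← B ∧ ¬p`,
where `p` is a new reserved atom. -/
def genDisj {α : Type} [DecidableEq α] (P : List (FClause α)) (p : α) :
    List (FClause α) :=
  P.map fun c =>
    if c.head = [] then ⟨[(p, true)], c.body ++ [(p, false)]⟩ else c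

/-- The atoms `a` such that `¬a` occurs in the head of some clause of `P`
(the set `S` of the FreeGen transformation), as a list. -/
def headNegs {α : Type} (P : List (FClause α)) : List α :=
  P.flatMap fun c => c.head.filterMap fun l => if l.2 = false then some l.1 else none

open scoped Classical in
/-- Replace the occurrence of `¬a` (for `a ∈ S`) by the positive atom `φ a`. -/
noncomputable def substLit {α : Type} (S : Set α) (φ : α → α) (l : α × Bool) :
    α × Bool :=
  if l.2 = false ∧ l.1 ∈ S then (φ l.1, true) else l

/-- Replace every occurrence of `¬a` (for `a ∈ S`) by `φ a` in a clause. -/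
noncomputable def FClause.subst {α : Type} (S : Set α) (φ : α → α) (c : FClause α) :
    FClause α :=
  ⟨c.head.map (substLit S φ), c.body.map (substLit S φ)⟩

/-- `Δ_S = ⋃_{a ∈ S} {φ(a) ← ¬a, ⊥ ← a ∧ φ(a)}`. -/
def deltaClauses {α : Type} (L : List α) (φ : α → α) : List (FClause α) :=
  L.flatMap fun a => [⟨[(φ a, true)], [(a, false)]⟩, ⟨[], [(a, true), (φ a, true)]⟩]

/-- `FreeGen(P) = P' ∪ Δ_S`. -/
noncomputable def freeGen {α : Type} (P : List (FClause α)) (φ : α → α) :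
    List (FClause α) :=
  P.map (FClause.subst {a | a ∈ headNegs P} φ) ++ deltaClauses (headNegs P) φ

open scoped Classical in
/-- The second reduction `redu2(P; ¬¬M)`: clauses whose body contains a literal
`¬a` with `a ∈ M` are deleted; in constraints, positive body literals `a ∈ M`
are deleted. -/
noncomputable def redu2 {α : Type} [DecidableEq α] (P : List (FClause α))
    (M : Set α) : List (FClause α) :=
  (P.filter fun c => decide (¬ ∃ l ∈ c.body, l.2 = false ∧ l.1 ∈ M)).map
    fun c =>
      if c.head = [] then
        ⟨[], c.body.filter fun l => decide (¬ (l.2 = true ∧ l.1 ∈ M))⟩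
      else c

/-- `P₂` is a conservative extension of `P₁`: `M₁` is an answer set of `P₁`
iff `M₂` is an answer set of `P₂`, where `M₁ = M₂ ∩ σ_{P₁}`. -/
def consExt {α : Type} (P1 P2 : List (AugClause α)) : Prop :=
  (∀ M2 : Set α, isAnswerSet P2 M2 → isAnswerSet P1 (M2 ∩ progSig P1)) ∧
  (∀ M1 : Set α, isAnswerSet P1 M1 →
    ∃ M2 : Set α, isAnswerSet P2 M2 ∧ M1 = M2 ∩ progSig P1)

/-- `P₂` is a strong conservative extension of the user program `P₁` (relative
to the user signature `U`): for every user program `P`, `P₂ ∪ P` is a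
conservative extension of `P₁ ∪ P`. -/
def strongConsExt {α : Type} (P1 P2 : List (AugClause α)) (U : Set α) : Prop :=
  ∀ P : List (AugClause α), progSig P ⊆ U → consExt (P1 ++ P) (P2 ++ P)

mutual
  /-- Negation normal form: push negations inward (no pending negation). -/
  def nnf0 {α : Type} : NF α → NF α
    | .var a => .var a
    | .top => .top
    | .bot => .bot
    | .conj A B => .conj (nnf0 A) (nnf0 B)
    | .disj A B => .disj (nnf0 A) (nnf0 B)
    | .neg A => nnf1 A
  /-- Negation normal form under one pending negation. -/
  def nnf1 {α : Type} : NF α → NF α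
    | .var a => .neg (.var a)
    | .top => .bot
    | .bot => .top
    | .conj A B => .disj (nnf1 A) (nnf1 B)
    | .disj A B => .conj (nnf1 A) (nnf1 B)
    | .neg A => nnf2 A
  /-- Negation normal form under two pending negations. -/
  def nnf2 {α : Type} : NF α → NF α
    | .var a => .neg (.neg (.var a))
    | .top => .top
    | .bot => .bot
    | .conj A B => .conj (nnf2 A) (nnf2 B)
    | .disj A B => .disj (nnf2 A) (nnf2 B)
    | .neg A => nnf1 A
end

/-- Conjunctive normal form (list of disjunction-lists of leaves). -/
def cnfNF {α : Type} : NF α → List (List (NF α))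
  | .conj A B => cnfNF A ++ cnfNF B
  | .disj A B => (cnfNF A).flatMap fun c => (cnfNF B).map fun d => c ++ d
  | F => [[F]]

/-- Disjunctive normal form (list of conjunction-lists of leaves). -/
def dnfNF {α : Type} : NF α → List (List (NF α))
  | .disj A B => dnfNF A ++ dnfNF B
  | .conj A B => (dnfNF A).flatMap fun c => (dnfNF B).map fun d => c ++ d
  | F => [[F]]

/-- Read a leaf as a literal (if it is one). -/
def leafLit {α : Type} : NF α → Option (α × Bool)
  | .var a => some (a, true)
  | .neg (.var a) => some (a, false)
  | _ => none

/-- Read a leaf `¬¬a` as the literal `¬a` to be moved to the other side. -/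
def dnegLit {α : Type} : NF α → Option (α × Bool)
  | .neg (.neg (.var a)) => some (a, false)
  | _ => none

/-- Build a free clause from a head disjunct-list and a body conjunct-list:
doubly negated atoms `¬¬a` in the head become `¬a` in the body and vice versa;
trivial clauses (⊤ in the head or ⊥ in the body) are removed. -/
def procClause {α : Type} [DecidableEq α] (hd bd : List (NF α)) :
    Option (FClause α) :=
  if NF.top ∈ hd ∨ NF.bot ∈ bd then none
  else some ⟨hd.filterMap leafLit ++ bd.filterMap dnegLit,
             bd.filterMap leafLit ++ hd.filterMap dnegLit⟩

/-- `AugFree(P)`: the free program obtained from the augmented program `P` by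
pushing negations inward, taking CNF of heads and DNF of bodies, splitting
conjunctions in heads and disjunctions in bodies into separate clauses, and
eliminating doubly negated atoms. -/
def augFree {α : Type} [DecidableEq α] (P : List (AugClause α)) :
    List (FClause α) :=
  P.flatMap fun c =>
    (cnfNF (nnf0 c.1)).flatMap fun hd =>
      (dnfNF (nnf0 c.2)).filterMap fun bd => procClause hd bd

/-- Positive formulas: no negation (in particular no ⊥) occurs. -/
def IsPositive {α : Type} : PropForm α → Prop
  | .var _ => True
  | .fals => False
  | .conj A B => IsPositive A ∧ IsPositive B
  | .disj A B => IsPositive A ∧ IsPositive B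
  | .impl A B => IsPositive A ∧ IsPositive B

/-- The set 𝐍 of two-negated formulas. -/
inductive IsTwoNeg {α : Type} : PropForm α → Prop
  | atom (a : α) : IsTwoNeg (neg (neg (var a)))
  | dneg {A} : IsTwoNeg A → IsTwoNeg (neg (neg A))
  | conj {A B} : IsTwoNeg A → IsTwoNeg B → IsTwoNeg (PropForm.conj A B)
  | disjL {A} (B) : IsTwoNeg A → IsTwoNeg (PropForm.disj A B)
  | disjR {A} (B) : IsTwoNeg A → IsTwoNeg (PropForm.disj B A)
  | himp {A} (B) : IsTwoNeg A → IsTwoNeg (PropForm.impl B A)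

theorem Deriv.mono {α : Type} {S T : Set (PropForm α)} (hST : S ⊆ T) {F : PropForm α}
    (h : Deriv S F) : Deriv T F := by
  induction h with
  | ax h => exact .ax (hST h)
  | mp _ _ ih₁ ih₂ => exact .mp ih₁ ih₂
  | _ =>
    first
      | exact .k .. | exact .s .. | exact .conjIntro .. | exact .conjElimL ..
      | exact .conjElimR .. | exact .disjIntroL .. | exact .disjIntroR ..
      | exact .disjElim .. | exact .falsElim ..

theorem Deriv.weaken {α : Type} {S : Set (PropForm α)} {F : PropForm α} (G : PropForm α)
    (h : Deriv S F) : Deriv (insert G S) F :=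
  h.mono (Set.subset_insert G S)

theorem Deriv.hyp {α : Type} (S : Set (PropForm α)) (G : PropForm α) :
    Deriv (insert G S) G :=
  .ax (Set.mem_insert G S)

theorem Deriv.explode {α : Type} {S : Set (PropForm α)} (F : PropForm α)
    (h : Deriv S fals) : Deriv S F :=
  .mp (.falsElim F) h

/-- The deduction theorem. -/
theorem Deriv.deduction {α : Type} {S : Set (PropForm α)} {A B : PropForm α}
    (h : Deriv (insert A S) B) : Deriv S (impl A B) := by
  have lift : ∀ {F}, Deriv S F → Deriv S (impl A F) := fun hF => .mp (.k _ _) hF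
  induction h with
  | ax h =>
    rcases h with rfl | h
    · exact .mp (.mp (.s _ (impl _ _) _) (.k _ _)) (.k _ fals)
    · exact lift (.ax h)
  | mp _ _ ih₁ ih₂ => exact .mp (.mp (.s _ _ _) ih₁) ih₂
  | _ =>
    first
      | exact lift (.k ..) | exact lift (.s ..) | exact lift (.conjIntro ..) | exact lift (.conjElimL ..)
      | exact lift (.conjElimR ..) | exact lift (.disjIntroL ..) | exact lift (.disjIntroR ..)
      | exact lift (.disjElim ..) | exact lift (.falsElim ..)

theorem Deriv.of_bigConj {α : Type} {S : Set (PropForm α)} {L : List (PropForm α)}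
    (h : Deriv S (bigConj L)) {G : PropForm α} (hG : G ∈ L) : Deriv S G := by
  induction L using bigConj.induct with
  | case1 => simp at hG
  | case2 A =>
    obtain rfl := List.mem_singleton.1 hG
    exact h
  | case3 A L hL ih =>
    rw [bigConj.eq_3 _ _ hL] at h
    rcases List.mem_cons.1 hG with rfl | hG
    · exact .mp (.conjElimL _ _) h
    · exact ih (.mp (.conjElimR _ _) h) hG

open scoped Classical in
/-- Forcing at the worlds below an added greatest world in which every atom holds, expressed as a
formula: an implication that fails at the greatest world is replaced by `⊥`. -/
noncomputable def topExt {α : Type} : PropForm α → PropForm α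
  | .var a => var a
  | .fals => fals
  | .conj A B => conj (topExt A) (topExt B)
  | .disj A B => disj (topExt A) (topExt B)
  | .impl A B =>
    if sat2 Set.univ A → sat2 Set.univ B then impl (topExt A) (topExt B) else fals

theorem IsPositive.sat2_univ {α : Type} {F : PropForm α} (hF : IsPositive F) :
    sat2 Set.univ F := by
  induction F with
  | var a => trivial
  | fals => exact hF
  | conj A B ihA ihB => exact ⟨ihA hF.1, ihB hF.2⟩
  | disj A B ihA ihB => exact .inl (ihA hF.1)
  | impl A B ihA ihB => exact fun _ => ihB hF.2

theorem IsPositive.topExt_eq {α : Type} {F : PropForm α} (hF : IsPositive F) :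
    topExt F = F := by
  induction F with
  | var a => rfl
  | fals => rfl
  | conj A B ihA ihB => rw [topExt, ihA hF.1, ihB hF.2]
  | disj A B ihA ihB => rw [topExt, ihA hF.1, ihB hF.2]
  | impl A B ihA ihB =>
    rw [topExt, ihA hF.1, ihB hF.2, if_pos fun _ => hF.2.sat2_univ]

theorem Deriv.fals_of_topExt {α : Type} {S : Set (PropForm α)} {F : PropForm α}
    (hF : ¬ sat2 Set.univ F) (h : Deriv S (topExt F)) : Deriv S fals := by
  induction F generalizing S with
  | var a => exact absurd trivial hF
  | fals => exact h
  | conj A B ihA ihB =>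
    by_cases hA : sat2 Set.univ A
    · exact ihB (fun hB => hF ⟨hA, hB⟩) (.mp (.conjElimR _ _) h)
    · exact ihA hA (.mp (.conjElimL _ _) h)
  | disj A B ihA ihB =>
    refine .mp (.mp (.mp (.disjElim _ _ _) (deduction ?_)) (deduction ?_)) h
    · exact ihA (fun hA => hF (.inl hA)) (.hyp _ _)
    · exact ihB (fun hB => hF (.inr hB)) (.hyp _ _)
  | impl A B ihA ihB => rwa [topExt, if_neg (c := sat2 Set.univ A → sat2 Set.univ B) hF] at h

theorem Deriv.sat2_of_topExt {α : Type} {S : Set (PropForm α)} {F : PropForm α}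
    (hS : ¬ Deriv S fals) (h : Deriv S (topExt F)) : sat2 Set.univ F :=
  by_contra fun hF => hS (h.fals_of_topExt hF)

theorem Deriv.topExt_impl {α : Type} {S : Set (PropForm α)} {A B : PropForm α}
    (hAB : ¬ Deriv S fals → sat2 Set.univ A → sat2 Set.univ B)
    (h : Deriv (insert (topExt A) S) (topExt B)) : Deriv S (topExt (impl A B)) := by
  by_cases hS : Deriv S fals
  · exact hS.explode _
  · rw [topExt, if_pos (hAB hS)]
    exact h.deduction

theorem Deriv.topExt_mp {α : Type} {S : Set (PropForm α)} {A B : PropForm α}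
    (h : Deriv S (topExt (impl A B))) (hA : Deriv S (topExt A)) : Deriv S (topExt B) := by
  by_cases hAB : sat2 Set.univ A → sat2 Set.univ B
  · rw [topExt, if_pos hAB] at h
    exact .mp h hA
  · rw [topExt, if_neg hAB] at h
    exact h.explode _

/-- `topExt` preserves intuitionistic theorems. -/
theorem Deriv.topExt_of_thm {α : Type} {F : PropForm α} (h : Deriv ∅ F) :
    Deriv ∅ (topExt F) := by
  induction h with
  | ax h => exact h.elim
  | mp _ _ ih₁ ih₂ => exact ih₁.topExt_mp ih₂
  | k A B =>
    refine topExt_impl (fun _ hA _ => hA) (topExt_impl (fun hS _ => ?_) ?_)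
    · exact sat2_of_topExt hS (.hyp _ _)
    · exact (hyp _ _).weaken _
  | s A B C =>
    refine topExt_impl (fun _ h₁ h₂ hA => h₁ hA (h₂ hA))
      (topExt_impl (fun hS h₂ hA => ?_) (topExt_impl (fun hS hA => ?_) ?_))
    · exact sat2_of_topExt (F := impl A (impl B C)) hS (.hyp _ _) hA (h₂ hA)
    · exact sat2_of_topExt (F := impl A (impl B C)) hS ((hyp _ _).weaken _) hA
        (sat2_of_topExt (F := impl A B) hS (.hyp _ _) hA)
    · exact topExt_mp (topExt_mp (((hyp _ _).weaken _).weaken _) (.hyp _ _))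
        (topExt_mp ((hyp _ _).weaken _) (.hyp _ _))
  | conjIntro A B =>
    refine topExt_impl (fun _ hA hB => ⟨hA, hB⟩) (topExt_impl (fun hS hB => ⟨?_, hB⟩) ?_)
    · exact sat2_of_topExt hS (.hyp _ _)
    · exact .mp (.mp (.conjIntro _ _) ((hyp _ _).weaken _)) (.hyp _ _)
  | conjElimL A B =>
    exact topExt_impl (fun _ h => h.1) (.mp (.conjElimL _ _) (.hyp _ (topExt (conj A B))))
  | conjElimR A B =>
    exact topExt_impl (fun _ h => h.2) (.mp (.conjElimR _ _) (.hyp _ (topExt (conj A B))))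
  | disjIntroL A B =>
    exact topExt_impl (fun _ h => .inl h) (.mp (.disjIntroL _ _) (.hyp _ _))
  | disjIntroR A B =>
    exact topExt_impl (fun _ h => .inr h) (.mp (.disjIntroR _ _) (.hyp _ _))
  | disjElim A B C =>
    refine topExt_impl (fun _ h₁ h₂ h => h.elim h₁ h₂)
      (topExt_impl (fun hS h₂ h => h.elim ?_ h₂) (topExt_impl (fun hS h => h.elim ?_ ?_) ?_))
    · exact sat2_of_topExt (F := impl A C) hS (.hyp _ _)
    · exact sat2_of_topExt (F := impl A C) hS ((hyp _ _).weaken _)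
    · exact sat2_of_topExt (F := impl B C) hS (.hyp _ _)
    · refine .mp (.mp (.mp (.disjElim _ _ _) (deduction ?_)) (deduction ?_))
        (.hyp _ (topExt (disj A B)))
      · exact topExt_mp ((((hyp _ _).weaken _).weaken _).weaken _) (.hyp _ _)
      · exact topExt_mp (((hyp _ _).weaken _).weaken _) (.hyp _ _)
  | falsElim A =>
    exact topExt_impl (fun _ h => h.elim) ((hyp _ fals).explode _)

theorem IsTwoNeg.sat2_univ {α : Type} {F : PropForm α} (hF : IsTwoNeg F) :
    sat2 Set.univ F := by
  induction hF with
  | atom a => exact fun h => h trivial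
  | dneg _ ih => exact fun h => h ih
  | conj _ _ ihA ihB => exact ⟨ihA, ihB⟩
  | disjL B _ ih => exact .inl ih
  | disjR B _ ih => exact .inr ih
  | himp B _ ih => exact fun _ => ih

theorem Deriv.topExt_neg_neg {α : Type} (S : Set (PropForm α)) {F : PropForm α}
    (hF : sat2 Set.univ F) : Deriv S (topExt (neg (neg F))) :=
  topExt_impl (fun _ h => h hF) (fals_of_topExt (F := neg F) (fun h => h hF) (.hyp _ _))

theorem IsTwoNeg.deriv_topExt {α : Type} (S : Set (PropForm α)) {F : PropForm α}
    (hF : IsTwoNeg F) : Deriv S (topExt F) := by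
  induction hF with
  | atom a => exact .topExt_neg_neg S trivial
  | dneg hA _ => exact .topExt_neg_neg S hA.sat2_univ
  | conj _ _ ihA ihB => exact .mp (.mp (.conjIntro _ _) ihA) ihB
  | disjL B _ ih => exact .mp (.disjIntroL _ _) ih
  | disjR B _ ih => exact .mp (.disjIntroR _ _) ih
  | himp B hA ih => exact .topExt_impl (fun _ _ => hA.sat2_univ) (ih.weaken _)

theorem Deriv.topExt_bigConj {α : Type} {S : Set (PropForm α)} {L : List (PropForm α)}
    (h : ∀ G ∈ L, Deriv S (topExt G)) : Deriv S (topExt (bigConj L)) := by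
  induction L using bigConj.induct with
  | case1 => exact topExt_impl (fun _ h => h) (.hyp _ _)
  | case2 A => exact h A (by simp)
  | case3 A L hL ih =>
    rw [bigConj.eq_3 _ _ hL]
    exact .mp (.mp (.conjIntro _ _) (h A (by simp)))
      (ih fun G hG => h G (List.mem_cons_of_mem A hG))

/-- if `Γ ⊆ 𝐏 ∪ 𝐍` and `A ∈ 𝐏` is positive, then `Γ ⊢_I A`
implies `Pos(Γ) ⊢_I A`. -/
theorem positive_part_suffices {α : Type} (Γ : Set (PropForm α)) (A : PropForm α)
    (hΓ : ∀ F ∈ Γ, IsPositive F ∨ IsTwoNeg F) (hA : IsPositive A)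
    (h : IProves Γ A) : IProves {F | F ∈ Γ ∧ IsPositive F} A := by
  classical
  obtain ⟨L, hL, hthm⟩ := h
  refine ⟨L.filter (IsPositive ·), fun G hG => ?_, Deriv.deduction ?_⟩
  · have hG := List.mem_filter.1 hG
    exact ⟨hL G hG.1, of_decide_eq_true hG.2⟩
  · rw [← hA.topExt_eq]
    refine (hthm.topExt_of_thm.weaken _).topExt_mp (.topExt_bigConj fun G hG => ?_)
    rcases hΓ G (hL G hG) with hpos | htwo
    · rw [hpos.topExt_eq]
      exact (Deriv.hyp _ _).of_bigConj (List.mem_filter.2 ⟨hG, decide_eq_true hpos⟩)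
    · exact htwo.deriv_topExt _

end ASP
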